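/- Let (x, v, v*) and (y, w, w*) be two regular triples with x, y ∈ GL(V). Then there exists g ∈ GL(V) with g∘x∘g⁻¹ = y, g(v) = w and w* = v*∘g⁻¹ if and only if v*(x^j v) = w*(y^j w) for every j ∈ ℕ and x and y have the same characteristic polynomial. -/

import Mathlib

/-- A linear map sending `X ^ i v` to `Y ^ i w` for `i < dim V` does so for every `i`, provided
`X` and `Y` have the same characteristic polynomial. -/
theorem LinearMap.map_pow_apply_of_charpoly_eq {F V : Type*} [Field F] [AddCommGroup V]
    [Module F V] [FiniteDimensional F V] {X Y : V →ₗ[F] V} (h : X.charpoly = Y.charpoly)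
    {v w : V} (g : V →ₗ[F] V)
    (hg : ∀ i < Module.finrank F V, g ((X ^ i) v) = (Y ^ i) w) (j : ℕ) :
    g ((X ^ j) v) = (Y ^ j) w := by
  rcases subsingleton_or_nontrivial V with hV | hV
  · exact Subsingleton.elim _ _
  have hne : X.charpoly ≠ 1 := by
    intro h1
    have := X.charpoly_natDegree
    rw [h1, Polynomial.natDegree_one] at this
    exact Module.finrank_pos.ne this
  have hdeg : (Polynomial.X ^ j %ₘ X.charpoly).natDegree < Module.finrank F V := by
    rw [← X.charpoly_natDegree]
    exact Polynomial.natDegree_modByMonic_lt _ X.charpoly_monic hne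
  rw [X.pow_eq_aeval_mod_charpoly, Y.pow_eq_aeval_mod_charpoly, ← h,
    Polynomial.aeval_eq_sum_range' hdeg, Polynomial.aeval_eq_sum_range' hdeg]
  simp only [LinearMap.sum_apply, LinearMap.smul_apply, map_sum, map_smul]
  exact Finset.sum_congr rfl fun i hi => by rw [hg i (Finset.mem_range.mp hi)]

/-- `(x, v, v*)` is a *regular* triple: `(v, xv, …, x^{n−1}v)` is a basis of `V` and
`(v*, v*∘x, …, v*∘x^{n−1})` is a basis of the dual space `V*`. -/
def RegularTriple (F : Type*) {V : Type*} [Field F] [AddCommGroup V] [Module F V]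
    (n : ℕ) (X : V →ₗ[F] V) (v : V) (vs : Module.Dual F V) : Prop :=
  (LinearIndependent F (fun i : Fin n => (X ^ (i : ℕ)) v) ∧
    Submodule.span F (Set.range fun i : Fin n => (X ^ (i : ℕ)) v) = ⊤) ∧
  (LinearIndependent F (fun i : Fin n => (vs ∘ₗ X ^ (i : ℕ) : Module.Dual F V)) ∧
    Submodule.span F (Set.range fun i : Fin n => (vs ∘ₗ X ^ (i : ℕ) : Module.Dual F V)) = ⊤)

/-- Two regular triples `(x, v, v*)` and `(y, w, w*)` with `x, y ∈ GL(V)` are conjugate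
under `GL(V)` (i.e. there is `g ∈ GL(V)` with `g∘x∘g⁻¹ = y`, `g(v) = w`, `w* = v*∘g⁻¹`)
if and only if `v*(x^j v) = w*(y^j w)` for all `j ∈ ℕ` and `x`, `y` have the same
characteristic polynomial. -/
theorem statement5 {F V : Type*} [Field F] [AddCommGroup V] [Module F V]
    [FiniteDimensional F V] {n : ℕ} (hn : 1 ≤ n) (hdim : Module.finrank F V = n)
    (x y : V ≃ₗ[F] V) (v w : V) (vs ws : Module.Dual F V)
    (hx : RegularTriple F n x.toLinearMap v vs) (hy : RegularTriple F n y.toLinearMap w ws) :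
    (∃ g : V ≃ₗ[F] V,
        g.toLinearMap ∘ₗ x.toLinearMap ∘ₗ g.symm.toLinearMap = y.toLinearMap ∧
          g v = w ∧ ws = vs ∘ₗ g.symm.toLinearMap) ↔
      ((∀ j : ℕ, vs ((x.toLinearMap ^ j) v) = ws ((y.toLinearMap ^ j) w)) ∧
        x.toLinearMap.charpoly = y.toLinearMap.charpoly) := by
  constructor
  · rintro ⟨g, hg, rfl, rfl⟩
    have hgx : ∀ u, y.toLinearMap (g u) = g (x.toLinearMap u) := fun u => by
      simp [← hg]
    have hpow : ∀ (j : ℕ) (u : V), (y.toLinearMap ^ j) (g u) = g ((x.toLinearMap ^ j) u) := by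
      intro j
      induction j with
      | zero => simp
      | succ j ih => intro u; rw [pow_succ, pow_succ, Module.End.mul_apply, hgx, ih]; rfl
    refine ⟨fun j => by simp [hpow], ?_⟩
    rw [← hg]
    exact (LinearEquiv.charpoly_conj g x.toLinearMap).symm
  · rintro ⟨hpair, hchar⟩
    let b := Module.Basis.mk hx.1.1 hx.1.2.ge
    let c := Module.Basis.mk hy.1.1 hy.1.2.ge
    let g := b.equiv c (Equiv.refl _)
    have hg : ∀ j : ℕ, g ((x.toLinearMap ^ j) v) = (y.toLinearMap ^ j) w := by
      refine LinearMap.map_pow_apply_of_charpoly_eq hchar g.toLinearMap fun i hi => ?_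
      have := b.equiv_apply ⟨i, hdim ▸ hi⟩ c (Equiv.refl _)
      simpa [b, c] using this
    have hgx : ∀ u, g (x u) = y (g u) := by
      refine LinearMap.congr_fun (f := g.toLinearMap ∘ₗ x.toLinearMap)
        (g := y.toLinearMap ∘ₗ g.toLinearMap) (b.ext fun i => ?_)
      have h1 := hg (i + 1)
      rw [pow_succ', pow_succ', Module.End.mul_apply, Module.End.mul_apply, ← hg i] at h1
      simpa [b] using h1
    have hgs : vs = ws ∘ₗ g.toLinearMap := by
      refine b.ext fun i => ?_
      simp [b, hpair, hg]
    refine ⟨g, ?_, by simpa using hg 0, ?_⟩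
    · ext u
      simp [hgx]
    · ext u
      simp [hgs]
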